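/- Let ζ be an extremal number and ε > 0. Then there are arbitrarily large X such that the system H(Q) ≤ X, |Q(ζ)| ≤ X^{−√5−ε} has no solution Q ∈ ℤ[T] that is irreducible of degree exactly three. -/

import Mathlib

open Polynomial

/-- Height of an integer polynomial: the maximum absolute value of its coefficients. -/
noncomputable def polyH (P : Polynomial ℤ) : ℝ :=
  (((P.support.sup fun i => (P.coeff i).natAbs) : ℕ) : ℝ)

/-- Evaluation of an integer polynomial at a real number. -/
noncomputable def pev (ζ : ℝ) (P : Polynomial ℤ) : ℝ := Polynomial.aeval ζ P

/-- Set of exponents η such that for arbitrarily large X the system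
    H(P) ≤ X, 0 < |P(ζ)| ≤ X^(−η) has a solution of degree at most n. -/
def wSet (n : ℕ) (ζ : ℝ) : Set ℝ :=
  {η | ∀ X₀ : ℝ, ∃ X : ℝ, X₀ ≤ X ∧ ∃ P : Polynomial ℤ,
    P.natDegree ≤ n ∧ polyH P ≤ X ∧ 0 < |pev ζ P| ∧ |pev ζ P| ≤ X ^ (-η)}

/-- The exponent w_n(ζ). -/
noncomputable def wExp (n : ℕ) (ζ : ℝ) : ℝ := sSup (wSet n ζ)

/-- Set of exponents η such that for all sufficiently large X the system
    H(P) ≤ X, 0 < |P(ζ)| ≤ X^(−η) has a solution of degree at most n. -/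
def whSet (n : ℕ) (ζ : ℝ) : Set ℝ :=
  {η | ∃ X₀ : ℝ, ∀ X : ℝ, X₀ ≤ X → ∃ P : Polynomial ℤ,
    P.natDegree ≤ n ∧ polyH P ≤ X ∧ 0 < |pev ζ P| ∧ |pev ζ P| ≤ X ^ (-η)}

/-- The uniform exponent ŵ_n(ζ). -/
noncomputable def whExp (n : ℕ) (ζ : ℝ) : ℝ := sSup (whSet n ζ)

/-- Set of exponents η such that for arbitrarily large X the system
    |x| ≤ X, max_{1≤i≤n} |ζ^i x − y_i| ≤ X^(−η) has a nonzero integer solution. -/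
def lamSet (n : ℕ) (ζ : ℝ) : Set ℝ :=
  {η | ∀ X₀ : ℝ, ∃ X : ℝ, X₀ ≤ X ∧ ∃ x : ℤ, ∃ y : Fin n → ℤ,
    (x ≠ 0 ∨ y ≠ 0) ∧ ((|x| : ℤ) : ℝ) ≤ X ∧
    ∀ i : Fin n, |ζ ^ ((i : ℕ) + 1) * (x : ℝ) - (y i : ℝ)| ≤ X ^ (-η)}

/-- The exponent λ_n(ζ). -/
noncomputable def lamExp (n : ℕ) (ζ : ℝ) : ℝ := sSup (lamSet n ζ)

/-- Set of exponents η such that for all sufficiently large X the system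
    |x| ≤ X, max_{1≤i≤n} |ζ^i x − y_i| ≤ X^(−η) has a nonzero integer solution. -/
def lamhSet (n : ℕ) (ζ : ℝ) : Set ℝ :=
  {η | ∃ X₀ : ℝ, ∀ X : ℝ, X₀ ≤ X → ∃ x : ℤ, ∃ y : Fin n → ℤ,
    (x ≠ 0 ∨ y ≠ 0) ∧ ((|x| : ℤ) : ℝ) ≤ X ∧
    ∀ i : Fin n, |ζ ^ ((i : ℕ) + 1) * (x : ℝ) - (y i : ℝ)| ≤ X ^ (-η)}

/-- The uniform exponent λ̂_n(ζ). -/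
noncomputable def lamhExp (n : ℕ) (ζ : ℝ) : ℝ := sSup (lamhSet n ζ)

/-- Set of exponents η such that for arbitrarily large X the polynomial system has
    at least j linearly independent solutions of degree at most n. -/
def wSetJ (n j : ℕ) (ζ : ℝ) : Set ℝ :=
  {η | ∀ X₀ : ℝ, ∃ X : ℝ, X₀ ≤ X ∧ ∃ P : Fin j → Polynomial ℤ,
    LinearIndependent ℤ P ∧ ∀ i : Fin j,
      (P i).natDegree ≤ n ∧ polyH (P i) ≤ X ∧ 0 < |pev ζ (P i)| ∧ |pev ζ (P i)| ≤ X ^ (-η)}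

/-- The exponent w_{n,j}(ζ). -/
noncomputable def wExpJ (n j : ℕ) (ζ : ℝ) : ℝ := sSup (wSetJ n j ζ)

/-- Set of exponents η such that for all sufficiently large X the polynomial system has
    at least j linearly independent solutions of degree at most n. -/
def whSetJ (n j : ℕ) (ζ : ℝ) : Set ℝ :=
  {η | ∃ X₀ : ℝ, ∀ X : ℝ, X₀ ≤ X → ∃ P : Fin j → Polynomial ℤ,
    LinearIndependent ℤ P ∧ ∀ i : Fin j,
      (P i).natDegree ≤ n ∧ polyH (P i) ≤ X ∧ 0 < |pev ζ (P i)| ∧ |pev ζ (P i)| ≤ X ^ (-η)}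

/-- The uniform exponent ŵ_{n,j}(ζ). -/
noncomputable def whExpJ (n j : ℕ) (ζ : ℝ) : ℝ := sSup (whSetJ n j ζ)

/-- Set of exponents η such that for arbitrarily large X the simultaneous approximation
    system has at least j linearly independent integer vector solutions. -/
def lamSetJ (n j : ℕ) (ζ : ℝ) : Set ℝ :=
  {η | ∀ X₀ : ℝ, ∃ X : ℝ, X₀ ≤ X ∧ ∃ v : Fin j → (Fin (n + 1) → ℤ),
    LinearIndependent ℤ v ∧ ∀ i : Fin j,
      ((|v i 0| : ℤ) : ℝ) ≤ X ∧
      ∀ t : Fin n, |ζ ^ ((t : ℕ) + 1) * ((v i 0 : ℤ) : ℝ) - ((v i t.succ : ℤ) : ℝ)| ≤ X ^ (-η)}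

/-- The exponent λ_{n,j}(ζ). -/
noncomputable def lamExpJ (n j : ℕ) (ζ : ℝ) : ℝ := sSup (lamSetJ n j ζ)

/-- Set of exponents η such that for all sufficiently large X the simultaneous approximation
    system has at least j linearly independent integer vector solutions. -/
def lamhSetJ (n j : ℕ) (ζ : ℝ) : Set ℝ :=
  {η | ∃ X₀ : ℝ, ∀ X : ℝ, X₀ ≤ X → ∃ v : Fin j → (Fin (n + 1) → ℤ),
    LinearIndependent ℤ v ∧ ∀ i : Fin j,
      ((|v i 0| : ℤ) : ℝ) ≤ X ∧
      ∀ t : Fin n, |ζ ^ ((t : ℕ) + 1) * ((v i 0 : ℤ) : ℝ) - ((v i t.succ : ℤ) : ℝ)| ≤ X ^ (-η)}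

/-- The uniform exponent λ̂_{n,j}(ζ). -/
noncomputable def lamhExpJ (n j : ℕ) (ζ : ℝ) : ℝ := sSup (lamhSetJ n j ζ)

/-- An extremal number: a real transcendental number with ŵ₂(ζ) = (3+√5)/2. -/
def IsExtremal (ζ : ℝ) : Prop :=
  Transcendental ℚ ζ ∧ whExp 2 ζ = (3 + Real.sqrt 5) / 2



open Filter Topology

/-- The value at `ζ` of the quadratic polynomial with coefficient vector `p`. -/
noncomputable def evalThree (ζ : ℝ) (p : Fin 3 → ℤ) : ℝ := p 0 + p 1 * ζ + p 2 * ζ ^ 2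

/-- The value at `ζ` of the cubic polynomial with coefficient vector `p`. -/
noncomputable def evalFour (ζ : ℝ) (p : Fin 4 → ℤ) : ℝ :=
  p 0 + p 1 * ζ + p 2 * ζ ^ 2 + p 3 * ζ ^ 3

/-- The vector product of two integer vectors. -/
def cross (p q : Fin 3 → ℤ) : Fin 3 → ℤ :=
  ![p 1 * q 2 - p 2 * q 1, p 2 * q 0 - p 0 * q 2, p 0 * q 1 - p 1 * q 0]

/-- The determinant of three integer vectors. -/
def detThree (p q r : Fin 3 → ℤ) : ℤ :=
  p 0 * cross q r 0 + p 1 * cross q r 1 + p 2 * cross q r 2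

/-- The minor of three vectors on the last three coordinates. -/
def minorThree (a b c : Fin 4 → ℤ) : ℤ :=
  a 1 * (b 2 * c 3 - b 3 * c 2) - a 2 * (b 1 * c 3 - b 3 * c 1) + a 3 * (b 1 * c 2 - b 2 * c 1)

/-- The determinant of four integer vectors. -/
def detFour (a b c d : Fin 4 → ℤ) : ℤ :=
  a 0 * minorThree b c d - b 0 * minorThree a c d + c 0 * minorThree a b d - d 0 * minorThree a b c

/-- A quadratic polynomial regarded as a cubic one. -/
def lowShift (p : Fin 3 → ℤ) : Fin 4 → ℤ := ![p 0, p 1, p 2, 0]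

/-- The product of a quadratic polynomial with the variable. -/
def highShift (p : Fin 3 → ℤ) : Fin 4 → ℤ := ![0, p 0, p 1, p 2]

lemma cross_apply_zero (p q : Fin 3 → ℤ) : cross p q 0 = p 1 * q 2 - p 2 * q 1 := rfl

lemma cross_apply_one (p q : Fin 3 → ℤ) : cross p q 1 = p 2 * q 0 - p 0 * q 2 := rfl

lemma cross_apply_two (p q : Fin 3 → ℤ) : cross p q 2 = p 0 * q 1 - p 1 * q 0 := rfl

lemma abs_mul_sub_mul_le {a b c d A B F : ℝ} (ha : |a| ≤ A) (hb : |b| ≤ F) (hc : |c| ≤ B)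
    (hd : |d| ≤ F) (hAB : A ≤ B) : |a * b - c * d| ≤ 2 * B * F := by
  have hB : 0 ≤ B := (abs_nonneg c).trans hc
  have h1 : |a * b| ≤ B * F := by
    rw [abs_mul]; exact mul_le_mul (ha.trans hAB) hb (abs_nonneg _) hB
  have h2 : |c * d| ≤ B * F := by
    rw [abs_mul]; exact mul_le_mul hc hd (abs_nonneg _) hB
  have := abs_sub (a * b) (c * d)
  linarith

/-- A nonzero integer solution of `b² = a c` is a multiple of `(x², x y, y²)`. -/
lemma exists_eq_mul_sq {a b c : ℤ} (ha : a ≠ 0) (h : b ^ 2 = a * c) :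
    ∃ g x y : ℤ, IsCoprime x y ∧ g ≠ 0 ∧ x ≠ 0 ∧ a = g * x ^ 2 ∧ b = g * (x * y) ∧
      c = g * y ^ 2 := by
  obtain ⟨x, y, hx, hy, hxy⟩ := extract_gcd a b
  have hco : IsCoprime x y := (gcd_isUnit_iff x y).mp hxy
  set d := gcd a b
  have hd0 : d ≠ 0 := by rintro h0; apply ha; rw [hx, h0, zero_mul]
  have hx0 : x ≠ 0 := by rintro h0; apply ha; rw [hx, h0, mul_zero]
  have h1 : x * c = d * y ^ 2 := by
    apply mul_left_cancel₀ hd0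
    rw [hx, hy] at h
    linear_combination -h
  obtain ⟨g, hg⟩ : x ∣ d := (hco.pow_right (n := 2)).dvd_of_dvd_mul_right ⟨c, h1.symm⟩
  refine ⟨g, x, y, hco, ?_, hx0, ?_, ?_, ?_⟩
  · rintro h0; apply hd0; rw [hg, h0, mul_zero]
  · rw [hx, hg]; ring
  · rw [hy, hg]; ring
  · apply mul_left_cancel₀ hx0
    rw [h1, hg]; ring

/-- The denominator of a root of a nonzero quadratic polynomial divides a nonzero coefficient. -/
lemma exists_dvd_of_isotropic {q : Fin 3 → ℤ} {x y : ℤ} (hxy : IsCoprime x y) (hx : x ≠ 0)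
    (hq : ∃ i, q i ≠ 0) (h : q 0 * x ^ 2 + q 1 * (x * y) + q 2 * y ^ 2 = 0) :
    ∃ i, q i ≠ 0 ∧ x ∣ q i := by
  by_cases h2 : q 2 = 0
  · have h' : q 0 * x + q 1 * y = 0 := by
      rw [h2] at h
      exact (mul_eq_zero.mp (by linear_combination h : x * (q 0 * x + q 1 * y) = 0)).resolve_left hx
    by_cases h1 : q 1 = 0
    · exfalso
      have h0 : q 0 = 0 := by
        rw [h1] at h'
        exact (mul_eq_zero.mp (by linear_combination h' : q 0 * x = 0)).resolve_right hx
      obtain ⟨i, hi⟩ := hq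
      fin_cases i <;> contradiction
    · exact ⟨1, h1, hxy.dvd_of_dvd_mul_right ⟨-q 0, by linear_combination h'⟩⟩
  · exact ⟨2, h2, (hxy.pow_right (n := 2)).dvd_of_dvd_mul_right
      ⟨-(q 0 * x + q 1 * y), by linear_combination h⟩⟩

section Estimates

variable {ζ A B E F : ℝ} {p q r : Fin 3 → ℤ}

lemma abs_cross_one_sub_le (hp : ∀ i, |(p i : ℝ)| ≤ A) (hq : ∀ i, |(q i : ℝ)| ≤ B) (hAB : A ≤ B)
    (hep : |evalThree ζ p| ≤ F) (heq : |evalThree ζ q| ≤ F) :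
    |(cross p q 1 : ℝ) - ζ * cross p q 0| ≤ 2 * B * F := by
  have : (cross p q 1 : ℝ) - ζ * cross p q 0 = p 2 * evalThree ζ q - q 2 * evalThree ζ p := by
    simp only [cross_apply_zero, cross_apply_one, evalThree]; push_cast; ring
  rw [this]
  exact abs_mul_sub_mul_le (hp 2) heq (hq 2) hep hAB

lemma abs_cross_two_sub_le (hp : ∀ i, |(p i : ℝ)| ≤ A) (hq : ∀ i, |(q i : ℝ)| ≤ B) (hAB : A ≤ B)
    (hep : |evalThree ζ p| ≤ F) (heq : |evalThree ζ q| ≤ F) :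
    |(cross p q 2 : ℝ) - ζ ^ 2 * cross p q 0| ≤ 2 * B * F := by
  have : (cross p q 2 : ℝ) - ζ ^ 2 * cross p q 0
      = -(p 1 * evalThree ζ q - q 1 * evalThree ζ p) := by
    simp only [cross_apply_zero, cross_apply_two, evalThree]; push_cast; ring
  rw [this, abs_neg]
  exact abs_mul_sub_mul_le (hp 1) heq (hq 1) hep hAB

lemma abs_cross_zero_le (hp : ∀ i, |(p i : ℝ)| ≤ A) (hq : ∀ i, |(q i : ℝ)| ≤ B) :
    |(cross p q 0 : ℝ)| ≤ 2 * A * B := by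
  have hA : 0 ≤ A := (abs_nonneg _).trans (hp 0)
  rw [cross_apply_zero]
  push_cast
  have h1 : |(p 1 : ℝ) * q 2| ≤ A * B := by
    rw [abs_mul]; exact mul_le_mul (hp 1) (hq 2) (abs_nonneg _) hA
  have h2 : |(p 2 : ℝ) * q 1| ≤ A * B := by
    rw [abs_mul]; exact mul_le_mul (hp 2) (hq 1) (abs_nonneg _) hA
  have := abs_sub ((p 1 : ℝ) * q 2) (p 2 * q 1)
  linarith

lemma abs_detThree_le (hp : ∀ i, |(p i : ℝ)| ≤ A) (hq : ∀ i, |(q i : ℝ)| ≤ A)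
    (hr : ∀ i, |(r i : ℝ)| ≤ B) (hAB : A ≤ B) (hep : |evalThree ζ p| ≤ E)
    (heq : |evalThree ζ q| ≤ F) (her : |evalThree ζ r| ≤ F) :
    |(detThree p q r : ℝ)| ≤ |(cross q r 0 : ℝ)| * E + 4 * (A * B * F) := by
  have hA : 0 ≤ A := (abs_nonneg _).trans (hp 0)
  have h1 := abs_cross_one_sub_le hq hr hAB heq her
  have h2 := abs_cross_two_sub_le hq hr hAB heq her
  have key : (detThree p q r : ℝ) = cross q r 0 * evalThree ζ p
      + p 1 * ((cross q r 1 : ℝ) - ζ * cross q r 0)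
      + p 2 * ((cross q r 2 : ℝ) - ζ ^ 2 * cross q r 0) := by
    simp only [detThree, evalThree]; push_cast; ring
  have b0 : |(cross q r 0 : ℝ) * evalThree ζ p| ≤ |(cross q r 0 : ℝ)| * E := by
    rw [abs_mul]; exact mul_le_mul_of_nonneg_left hep (abs_nonneg _)
  have b1 : |(p 1 : ℝ) * ((cross q r 1 : ℝ) - ζ * cross q r 0)| ≤ A * (2 * B * F) := by
    rw [abs_mul]; exact mul_le_mul (hp 1) h1 (abs_nonneg _) hA
  have b2 : |(p 2 : ℝ) * ((cross q r 2 : ℝ) - ζ ^ 2 * cross q r 0)| ≤ A * (2 * B * F) := by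
    rw [abs_mul]; exact mul_le_mul (hp 2) h2 (abs_nonneg _) hA
  rw [key]
  refine (abs_add_three _ _ _).trans ?_
  linarith

lemma one_le_abs_intCast {n : ℤ} (hn : n ≠ 0) : (1 : ℝ) ≤ |(n : ℝ)| := by
  exact_mod_cast Int.one_le_abs hn

/-- Three independent vectors with small values force the largest height to be large. -/
lemma one_le_of_detThree_ne_zero (hp : ∀ i, |(p i : ℝ)| ≤ A) (hq : ∀ i, |(q i : ℝ)| ≤ A)
    (hr : ∀ i, |(r i : ℝ)| ≤ B) (hAB : A ≤ B) (hep : |evalThree ζ p| ≤ E)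
    (heq : |evalThree ζ q| ≤ F) (her : |evalThree ζ r| ≤ F) (hFE : F ≤ E)
    (hdet : detThree p q r ≠ 0) : 1 ≤ 6 * (A * B * E) := by
  have hA : 0 ≤ A := (abs_nonneg _).trans (hp 0)
  have hE : 0 ≤ E := (abs_nonneg _).trans hep
  have h1 := abs_detThree_le hp hq hr hAB hep heq her
  have h2 := one_le_abs_intCast hdet
  have h3 := mul_le_mul_of_nonneg_right (abs_cross_zero_le hq hr) hE
  have h4 : A * B * F ≤ A * B * E :=
    mul_le_mul_of_nonneg_left hFE (mul_nonneg hA (hA.trans hAB))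
  linarith

/-- The resultant of the last two of three independent vectors with small values is nonzero. -/
lemma cross_one_sq_ne (hp : ∀ i, |(p i : ℝ)| ≤ A) (hq : ∀ i, |(q i : ℝ)| ≤ A)
    (hr : ∀ i, |(r i : ℝ)| ≤ B) (hAB : A ≤ B) (hep : |evalThree ζ p| ≤ E)
    (heq : |evalThree ζ q| ≤ F) (her : |evalThree ζ r| ≤ F)
    (hE : A ^ 2 * E < 1 / 5) (hF : A * B * F < 1 / 5) (hdet : detThree p q r ≠ 0) :
    cross q r 1 ^ 2 ≠ cross q r 0 * cross q r 2 := by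
  intro hres
  have hE0 : 0 ≤ E := (abs_nonneg _).trans hep
  have hle := abs_detThree_le hp hq hr hAB hep heq her
  have hone := one_le_abs_intCast hdet
  rcases eq_or_ne (cross q r 0) 0 with h0 | h0
  · rw [h0] at hle
    simp only [Int.cast_zero, abs_zero, zero_mul] at hle
    linarith
  obtain ⟨g, x, y, hxy, hg, hx, h1, h2, h3⟩ := exists_eq_mul_sq h0 hres
  set c := cross q r with hc
  have horth : q 0 * x ^ 2 + q 1 * (x * y) + q 2 * y ^ 2 = 0 := by
    have : q 0 * c 0 + q 1 * c 1 + q 2 * c 2 = 0 := by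
      simp only [hc, cross_apply_zero, cross_apply_one, cross_apply_two]; ring
    rw [h1, h2, h3] at this
    exact (mul_eq_zero.mp (by linear_combination this :
      g * (q 0 * x ^ 2 + q 1 * (x * y) + q 2 * y ^ 2) = 0)).resolve_left hg
  have hq0 : ∃ i, q i ≠ 0 := by
    by_contra! hzero
    apply h0
    rw [hc, cross_apply_zero, hzero, hzero]
    ring
  have hxA : |(x : ℝ)| ≤ A := by
    obtain ⟨i, hi, hdvd⟩ := exists_dvd_of_isotropic hxy hx hq0 horth
    have := Int.le_of_dvd (abs_pos.mpr hi) ((abs_dvd_abs x (q i)).mpr hdvd)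
    have h' : |(x : ℝ)| ≤ |(q i : ℝ)| := by exact_mod_cast this
    exact h'.trans (hq i)
  have hgdet : |(g : ℝ)| ≤ |(detThree p q r : ℝ)| := by
    have hdvd : g ∣ detThree p q r :=
      ⟨p 0 * x ^ 2 + p 1 * (x * y) + p 2 * y ^ 2, by
        rw [detThree, ← hc, h1, h2, h3]; ring⟩
    have := Int.le_of_dvd (abs_pos.mpr hdet) ((abs_dvd_abs g _).mpr hdvd)
    exact_mod_cast this
  have hg1 := one_le_abs_intCast hg
  have hc0 : |(c 0 : ℝ)| ≤ |(g : ℝ)| * A ^ 2 := by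
    rw [h1]; push_cast
    rw [abs_mul, abs_pow]
    exact mul_le_mul_of_nonneg_left (pow_le_pow_left₀ (abs_nonneg _) hxA 2) (abs_nonneg _)
  have h4 := mul_le_mul_of_nonneg_right hc0 hE0
  have h5 : |(g : ℝ)| * (A ^ 2 * E) ≤ |(g : ℝ)| * (1 / 5) :=
    mul_le_mul_of_nonneg_left hE.le (abs_nonneg _)
  nlinarith

end Estimates

section FourVectors

variable {ζ : ℝ} {a b c d : Fin 4 → ℤ} {α β γ δ : ℝ}

lemma abs_mul_sub_mul_le_add {x y z w B C : ℝ} (hx : |x| ≤ B) (hy : |y| ≤ C) (hz : |z| ≤ B)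
    (hw : |w| ≤ C) : |x * y - z * w| ≤ 2 * (B * C) := by
  have hB : 0 ≤ B := (abs_nonneg x).trans hx
  have h1 : |x * y| ≤ B * C := by
    rw [abs_mul]; exact mul_le_mul hx hy (abs_nonneg _) hB
  have h2 : |z * w| ≤ B * C := by
    rw [abs_mul]; exact mul_le_mul hz hw (abs_nonneg _) hB
  have := abs_sub (x * y) (z * w)
  linarith

lemma abs_minorThree_le (ha : ∀ i, |(a i : ℝ)| ≤ α) (hb : ∀ i, |(b i : ℝ)| ≤ β)
    (hc : ∀ i, |(c i : ℝ)| ≤ γ) : |(minorThree a b c : ℝ)| ≤ 6 * (α * β * γ) := by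
  have hα : 0 ≤ α := (abs_nonneg _).trans (ha 0)
  have key : ∀ i j k l m : Fin 4, |(a i : ℝ) * ((b j : ℝ) * c k - b l * c m)|
      ≤ α * (2 * (β * γ)) := by
    intro i j k l m
    rw [abs_mul]
    exact mul_le_mul (ha i) (abs_mul_sub_mul_le_add (hb j) (hc k) (hb l) (hc m))
      (abs_nonneg _) hα
  have h1 := abs_le.mp (key 1 2 3 3 2)
  have h2 := abs_le.mp (key 2 1 3 3 1)
  have h3 := abs_le.mp (key 3 1 2 2 1)
  rw [abs_le, minorThree]
  push_cast
  constructor <;> linarith [h1.1, h1.2, h2.1, h2.2, h3.1, h3.2]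

lemma detFour_eq (ζ : ℝ) (a b c d : Fin 4 → ℤ) : (detFour a b c d : ℝ) =
    evalFour ζ a * minorThree b c d - evalFour ζ b * minorThree a c d
      + evalFour ζ c * minorThree a b d - evalFour ζ d * minorThree a b c := by
  simp only [detFour, evalFour, minorThree]
  push_cast
  ring

lemma abs_detFour_le (ha : ∀ i, |(a i : ℝ)| ≤ α) (hb : ∀ i, |(b i : ℝ)| ≤ β)
    (hc : ∀ i, |(c i : ℝ)| ≤ γ) (hd : ∀ i, |(d i : ℝ)| ≤ δ) :
    |(detFour a b c d : ℝ)| ≤ 6 * (|evalFour ζ a| * (β * γ * δ) + |evalFour ζ b| * (α * γ * δ)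
      + |evalFour ζ c| * (α * β * δ) + |evalFour ζ d| * (α * β * γ)) := by
  have key : ∀ x m t : ℝ, |m| ≤ 6 * t → |x * m| ≤ |x| * (6 * t) := by
    intro x m t h
    rw [abs_mul]
    exact mul_le_mul_of_nonneg_left h (abs_nonneg _)
  have h1 := abs_le.mp (key (evalFour ζ a) _ _ (abs_minorThree_le hb hc hd))
  have h2 := abs_le.mp (key (evalFour ζ b) _ _ (abs_minorThree_le ha hc hd))
  have h3 := abs_le.mp (key (evalFour ζ c) _ _ (abs_minorThree_le ha hb hd))
  have h4 := abs_le.mp (key (evalFour ζ d) _ _ (abs_minorThree_le ha hb hc))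
  rw [detFour_eq ζ, abs_le]
  constructor <;> linarith [h1.1, h1.2, h2.1, h2.2, h3.1, h3.2, h4.1, h4.2]

/-- Cramer's rule in dimension four. -/
lemma detFour_mul (a b c d q : Fin 4 → ℤ) (i : Fin 4) : detFour a b c d * q i =
    detFour q b c d * a i + detFour a q c d * b i + detFour a b q d * c i
      + detFour a b c q * d i := by
  fin_cases i <;>
    simp only [detFour, minorThree, Fin.zero_eta, Fin.mk_one, Fin.reduceFinMk] <;> ring

lemma detFour_shift (p q : Fin 3 → ℤ) :
    detFour (lowShift p) (highShift p) (lowShift q) (highShift q) =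
      cross p q 1 ^ 2 - cross p q 0 * cross p q 2 := by
  simp [detFour, minorThree, lowShift, highShift, cross]
  ring

lemma detFour_swap_right (a b c d : Fin 4 → ℤ) : detFour a b d c = -detFour a b c d := by
  simp only [detFour, minorThree]; ring

end FourVectors

section Shift

variable {ζ A : ℝ} {p : Fin 3 → ℤ}

lemma abs_lowShift_le (hp : ∀ i, |(p i : ℝ)| ≤ A) (i : Fin 4) : |(lowShift p i : ℝ)| ≤ A := by
  have hA : 0 ≤ A := (abs_nonneg _).trans (hp 0)
  fin_cases i
  · exact hp 0
  · exact hp 1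
  · exact hp 2
  · simpa [lowShift] using hA

lemma abs_highShift_le (hp : ∀ i, |(p i : ℝ)| ≤ A) (i : Fin 4) : |(highShift p i : ℝ)| ≤ A := by
  have hA : 0 ≤ A := (abs_nonneg _).trans (hp 0)
  fin_cases i
  · simpa [highShift] using hA
  · exact hp 0
  · exact hp 1
  · exact hp 2

lemma evalFour_lowShift : evalFour ζ (lowShift p) = evalThree ζ p := by
  simp [evalFour, evalThree, lowShift]

lemma evalFour_highShift : evalFour ζ (highShift p) = ζ * evalThree ζ p := by
  simp [evalFour, evalThree, highShift]; ring

end Shift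

/-- A cubic polynomial that is small at `ζ` and not too large is a multiple of the quadratic
polynomial `p`, provided `p` and `q` are coprime and both are small at `ζ`. -/
lemma exists_mul_eq_shift {ζ A B F G Y : ℝ} {p q : Fin 3 → ℤ} {s : Fin 4 → ℤ}
    (hp : ∀ i, |(p i : ℝ)| ≤ A) (hq : ∀ i, |(q i : ℝ)| ≤ B) (hs : ∀ i, |(s i : ℝ)| ≤ Y)
    (hAB : A ≤ B) (hep : |evalThree ζ p| ≤ F) (heq : |evalThree ζ q| ≤ F)
    (hes : |evalFour ζ s| ≤ G) (h1 : 12 * (1 + |ζ|) * (A * B * Y * F) < 1 / 2)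
    (h2 : 6 * (A ^ 2 * B * G) < 1 / 2)
    (hres : cross p q 1 ^ 2 ≠ cross p q 0 * cross p q 2) :
    ∃ n u v : ℤ, n ≠ 0 ∧ ∀ i, n * s i = u * lowShift p i + v * highShift p i := by
  have hA : 0 ≤ A := (abs_nonneg _).trans (hp 0)
  have hB : 0 ≤ B := hA.trans hAB
  have hY : 0 ≤ Y := (abs_nonneg _).trans (hs 0)
  have hF : 0 ≤ F := (abs_nonneg _).trans hep
  have main : ∀ c : Fin 4 → ℤ, (∀ i, |(c i : ℝ)| ≤ B) → |evalFour ζ c| ≤ (1 + |ζ|) * F →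
      detFour (lowShift p) (highShift p) c s = 0 := by
    intro c hc hec
    by_contra hne
    have hone := one_le_abs_intCast hne
    have hle := abs_detFour_le (ζ := ζ) (abs_lowShift_le hp) (abs_highShift_le hp) hc hs
    rw [evalFour_lowShift, evalFour_highShift, abs_mul] at hle
    have e1 : |evalThree ζ p| * (A * B * Y) ≤ F * (A * B * Y) := by gcongr
    have e2 : |ζ| * |evalThree ζ p| * (A * B * Y) ≤ |ζ| * F * (A * B * Y) := by gcongr
    have e3 : |evalFour ζ c| * (A * A * Y) ≤ (1 + |ζ|) * F * (A * B * Y) := by gcongr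
    have e4 : |evalFour ζ s| * (A * A * B) ≤ G * (A * A * B) := by gcongr
    linarith
  have hlow := main (lowShift q) (abs_lowShift_le hq) (by
    rw [evalFour_lowShift]
    nlinarith [abs_nonneg ζ])
  have hhigh := main (highShift q) (abs_highShift_le hq) (by
    rw [evalFour_highShift, abs_mul]
    nlinarith [abs_nonneg ζ])
  refine ⟨detFour (lowShift p) (highShift p) (lowShift q) (highShift q),
    detFour s (highShift p) (lowShift q) (highShift q),
    detFour (lowShift p) s (lowShift q) (highShift q), ?_, fun i => ?_⟩
  · rw [detFour_shift]
    exact sub_ne_zero.mpr hres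
  · rw [detFour_mul, hlow, detFour_swap_right _ _ (highShift q) s, hhigh]
    ring

/-- An irreducible cubic polynomial is not a rational multiple of a product of a linear and a
quadratic polynomial. -/
lemma not_mul_eq_shift {Q : ℤ[X]} (hQ : Irreducible Q) (hdeg : Q.natDegree = 3)
    {p : Fin 3 → ℤ} {n u v : ℤ} (hn : n ≠ 0)
    (h : ∀ i : Fin 4, n * Q.coeff i = u * lowShift p i + v * highShift p i) : False := by
  have hmul : C n * Q = (C v * X + C u) * (C (p 2) * X ^ 2 + C (p 1) * X + C (p 0)) := by
    have hsum : Q = C (Q.coeff 3) * X ^ 3 + C (Q.coeff 2) * X ^ 2 + C (Q.coeff 1) * X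
        + C (Q.coeff 0) := by
      conv_lhs => rw [Q.as_sum_range_C_mul_X_pow, hdeg]
      simp [Finset.sum_range_succ]
      ring
    have h0 : n * Q.coeff 0 = u * p 0 := by simpa [lowShift, highShift] using h 0
    have h1 : n * Q.coeff 1 = u * p 1 + v * p 0 := by simpa [lowShift, highShift] using h 1
    have h2 : n * Q.coeff 2 = u * p 2 + v * p 1 := by simpa [lowShift, highShift] using h 2
    have h3 : n * Q.coeff 3 = v * p 2 := by simpa [lowShift, highShift] using h 3
    have e0 := congrArg (C : ℤ →+* ℤ[X]) h0
    have e1 := congrArg (C : ℤ →+* ℤ[X]) h1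
    have e2 := congrArg (C : ℤ →+* ℤ[X]) h2
    have e3 := congrArg (C : ℤ →+* ℤ[X]) h3
    simp only [map_mul, map_add] at e0 e1 e2 e3
    rw [hsum]
    linear_combination e0 + e1 * X + e2 * X ^ 2 + e3 * X ^ 3
  have hne : C n * Q ≠ 0 := mul_ne_zero (C_ne_zero.mpr hn) hQ.ne_zero
  have hne' := hne
  rw [hmul] at hne'
  rcases hQ.prime.dvd_or_dvd (Dvd.intro_left _ hmul) with hd | hd
  · have := natDegree_le_of_dvd hd (left_ne_zero_of_mul hne')
    have := natDegree_linear_le (a := v) (b := u)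
    omega
  · have := natDegree_le_of_dvd hd (right_ne_zero_of_mul hne')
    have := natDegree_quadratic_le (a := p 2) (b := p 1) (c := p 0)
    omega

/-- Dividing a vector by the greatest common divisor of its coordinates gives a vector whose
nonzero integer multiples have larger values. -/
lemma exists_primitive {ζ X E : ℝ} {p : Fin 3 → ℤ} (hp : ∀ i, |(p i : ℝ)| ≤ X)
    (h0 : evalThree ζ p ≠ 0) (hE : |evalThree ζ p| ≤ E) :
    ∃ q : Fin 3 → ℤ, (∀ i, |(q i : ℝ)| ≤ X) ∧ evalThree ζ q ≠ 0 ∧ |evalThree ζ q| ≤ E ∧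
      ∀ r : Fin 3 → ℤ, cross q r = 0 → evalThree ζ r ≠ 0 → |evalThree ζ q| ≤ |evalThree ζ r| := by
  obtain ⟨d, hd⟩ := (IsPrincipalIdealRing.principal (Ideal.span (Set.range p))).principal
  have hdvd : ∀ i, ∃ k, p i = d * k := by
    intro i
    have : p i ∈ Ideal.span (Set.range p) := Ideal.subset_span ⟨i, rfl⟩
    rw [hd] at this
    exact Ideal.mem_span_singleton.mp this
  choose q hq using hdvd
  obtain ⟨u, hu⟩ : ∃ u : Fin 3 → ℤ, ∑ i, u i * p i = d := by
    have : d ∈ Ideal.span (Set.range p) := by rw [hd]; exact Ideal.mem_span_singleton_self d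
    exact (Ideal.mem_span_range_iff_exists_fun).mp this
  have hev : evalThree ζ p = d * evalThree ζ q := by
    simp only [evalThree, hq]; push_cast; ring
  have hd0 : d ≠ 0 := by rintro rfl; apply h0; rw [hev]; simp
  have hd1 := one_le_abs_intCast hd0
  have huq : u 0 * q 0 + u 1 * q 1 + u 2 * q 2 = 1 := by
    apply mul_left_cancel₀ hd0
    rw [Fin.sum_univ_three, hq, hq, hq] at hu
    linear_combination hu
  refine ⟨q, fun i => (le_trans ?_ (hp i)), right_ne_zero_of_mul (hev ▸ h0), le_trans ?_ hE, ?_⟩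
  · rw [hq]; push_cast; rw [abs_mul]
    exact le_mul_of_one_le_left (abs_nonneg _) hd1
  · rw [hev, abs_mul]
    exact le_mul_of_one_le_left (abs_nonneg _) hd1
  · intro r hr hr0
    have c0 := cross_apply_zero q r
    have c1 := cross_apply_one q r
    have c2 := cross_apply_two q r
    rw [hr, Pi.zero_apply] at c0 c1 c2
    set k := u 0 * r 0 + u 1 * r 1 + u 2 * r 2 with hk
    have r0 : r 0 = k * q 0 := by
      linear_combination (-r 0) * huq - u 2 * c1 + u 1 * c2
    have r1 : r 1 = k * q 1 := by
      linear_combination (-r 1) * huq - u 0 * c2 + u 2 * c0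
    have r2 : r 2 = k * q 2 := by
      linear_combination (-r 2) * huq - u 1 * c0 + u 0 * c1
    have hevr : evalThree ζ r = k * evalThree ζ q := by
      simp only [evalThree, r0, r1, r2]; push_cast; ring
    have hk0 : k ≠ 0 := by rintro hk0; apply hr0; rw [hevr, hk0]; simp
    rw [hevr, abs_mul]
    exact le_mul_of_one_le_left (abs_nonneg _) (one_le_abs_intCast hk0)

/-- Coordinates of consecutive vector products in a sequence of coplanar vectors are
proportional. -/
lemma cross_proportional {P : ℕ → Fin 3 → ℤ} (hne : ∀ j, cross (P j) (P (j + 1)) ≠ 0)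
    (hdet : ∀ j, detThree (P j) (P (j + 1)) (P (j + 2)) = 0) {a : Fin 3}
    (ha : cross (P 0) (P 1) a ≠ 0) (j : ℕ) :
    cross (P j) (P (j + 1)) a ≠ 0 ∧ ∀ b, cross (P 0) (P 1) a * cross (P j) (P (j + 1)) b =
      cross (P 0) (P 1) b * cross (P j) (P (j + 1)) a := by
  induction j with
  | zero => exact ⟨ha, fun b => mul_comm _ _⟩
  | succ j ih =>
    obtain ⟨hja, hjb⟩ := ih
    have hpar : ∀ b c, cross (P j) (P (j + 1)) c * cross (P (j + 1)) (P (j + 2)) b =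
        cross (P j) (P (j + 1)) b * cross (P (j + 1)) (P (j + 2)) c := by
      have h := hdet j
      simp only [detThree, cross_apply_zero, cross_apply_one, cross_apply_two] at h
      intro b c
      fin_cases b <;> fin_cases c <;>
        simp only [Fin.zero_eta, Fin.mk_one, Fin.reduceFinMk, cross_apply_zero, cross_apply_one,
          cross_apply_two] <;>
        first
          | ring1
          | linear_combination P (j + 1) 0 * h
          | linear_combination P (j + 1) 1 * h
          | linear_combination P (j + 1) 2 * h
          | linear_combination -P (j + 1) 0 * h
          | linear_combination -P (j + 1) 1 * h
          | linear_combination -P (j + 1) 2 * h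
    constructor
    · intro h0
      apply hne (j + 1)
      ext b
      have := hpar b a
      rw [h0, mul_zero] at this
      exact (mul_eq_zero.mp this).resolve_left hja
    · intro b
      apply mul_left_cancel₀ hja
      linear_combination (cross (P 0) (P 1) a) * hpar b a
        + cross (P (j + 1)) (P (j + 2)) a * hjb b

/-- Vectors of small value in a sequence cannot all be coplanar. -/
lemma exists_detThree_ne_zero {ζ C η : ℝ} (hζ : Irrational ζ) (hη : 1 < η)
    {P : ℕ → Fin 3 → ℤ} {X : ℕ → ℝ} (hX : Tendsto X atTop atTop) (hX0 : ∀ j, 0 < X j)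
    (hmono : Monotone X) (hP : ∀ j i, |(P j i : ℝ)| ≤ X j)
    (hev : ∀ j, |evalThree ζ (P j)| ≤ C * X (j + 1) ^ (-η)) (hC : 0 ≤ C)
    (hne : ∀ j, cross (P j) (P (j + 1)) ≠ 0) :
    ∃ j, detThree (P j) (P (j + 1)) (P (j + 2)) ≠ 0 := by
  by_contra! hdet
  set w := cross (P 0) (P 1) with hw
  obtain ⟨a, ha⟩ : ∃ a, w a ≠ 0 := by
    by_contra! h
    exact hne 0 (funext h)
  have hprop := cross_proportional hne hdet ha
  have hlim : Tendsto (fun j => |(w a : ℝ)| * (2 * C * X (j + 1) ^ (-(η - 1)))) atTop (𝓝 0) := by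
    have h1 := (tendsto_rpow_neg_atTop (sub_pos.mpr hη)).comp (hX.comp (tendsto_add_atTop_nat 1))
    simpa using (h1.const_mul (2 * C)).const_mul |(w a : ℝ)|
  have hzero : ∀ (b : Fin 3) (t : ℝ), (∀ j, |(cross (P j) (P (j + 1)) b : ℝ)
      - t * cross (P j) (P (j + 1)) 0| ≤ 2 * C * X (j + 1) ^ (-(η - 1))) → (w b : ℝ) = t * w 0 := by
    intro b t hb
    refine sub_eq_zero.mp (abs_nonpos_iff.mp (ge_of_tendsto' hlim fun j => ?_))
    obtain ⟨hja, hjb⟩ := hprop j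
    set c := cross (P j) (P (j + 1))
    have e1 : (w a : ℝ) * c b = w b * c a := by exact_mod_cast hjb b
    have e2 : (w a : ℝ) * c 0 = w 0 * c a := by exact_mod_cast hjb 0
    have e3 : ((w b : ℝ) - t * w 0) * c a = w a * (c b - t * c 0) := by
      linear_combination t * e2 - e1
    calc |(w b : ℝ) - t * w 0| ≤ |(w b : ℝ) - t * w 0| * |(c a : ℝ)| :=
          le_mul_of_one_le_right (abs_nonneg _) (one_le_abs_intCast hja)
      _ = |(w a : ℝ)| * |c b - t * c 0| := by rw [← abs_mul, e3, abs_mul]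
      _ ≤ _ := mul_le_mul_of_nonneg_left (hb j) (abs_nonneg _)
  have hsmall : ∀ j, 2 * X (j + 1) * (C * X (j + 1) ^ (-η)) = 2 * C * X (j + 1) ^ (-(η - 1)) := by
    intro j
    rw [show -(η - 1) = 1 + -η by ring, Real.rpow_add (hX0 _), Real.rpow_one]
    ring
  have hev' : ∀ j, |evalThree ζ (P (j + 1))| ≤ C * X (j + 1) ^ (-η) := fun j =>
    (hev (j + 1)).trans (mul_le_mul_of_nonneg_left (Real.rpow_le_rpow_of_nonpos (hX0 _)
      (hmono (Nat.le_succ _)) (by linarith)) hC)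
  have h1 : (w 1 : ℝ) = ζ * w 0 := hzero 1 ζ fun j => by
    rw [← hsmall]
    exact abs_cross_one_sub_le (hP j) (hP (j + 1)) (hmono (Nat.le_succ j)) (hev j) (hev' j)
  have h2 : (w 2 : ℝ) = ζ ^ 2 * w 0 := hzero 2 (ζ ^ 2) fun j => by
    rw [← hsmall]
    exact abs_cross_two_sub_le (hP j) (hP (j + 1)) (hmono (Nat.le_succ j)) (hev j) (hev' j)
  have h0 : w 0 = 0 := by
    by_contra h0
    exact (hζ.mul_intCast h0).ne_int (w 1) h1.symm
  rw [h0] at h1 h2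
  simp only [Int.cast_zero, mul_zero, Int.cast_eq_zero] at h1 h2
  fin_cases a
  · exact ha h0
  · exact ha h1
  · exact ha h2

/-- If quadratic polynomials give uniform approximation of exponent `η > 1`, then there are three
independent ones with heights and values controlled by two consecutive parameters. -/
lemma exists_independent_triple {ζ η T : ℝ} (hζ : Irrational ζ) (hη : 1 < η)
    (h : ∀ X : ℝ, T ≤ X → ∃ p : Fin 3 → ℤ, (∀ i, |(p i : ℝ)| ≤ X) ∧ evalThree ζ p ≠ 0 ∧
      |evalThree ζ p| ≤ X ^ (-η)) (M : ℝ) :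
    ∃ (A B : ℝ) (p q r : Fin 3 → ℤ), M ≤ A ∧ A ≤ B ∧ (∀ i, |(p i : ℝ)| ≤ A) ∧
      (∀ i, |(q i : ℝ)| ≤ A) ∧ (∀ i, |(r i : ℝ)| ≤ B) ∧
      |evalThree ζ p| ≤ 2 ^ η * A ^ (-η) ∧ |evalThree ζ q| ≤ 2 ^ η * B ^ (-η) ∧
      |evalThree ζ r| ≤ 2 ^ η * B ^ (-η) ∧ detThree p q r ≠ 0 := by
  set S := max (max T M) 1 with hS
  have hη0 : 0 < η := by linarith
  have hprim : ∀ X : ℝ, ∃ q : Fin 3 → ℤ, S ≤ X → (∀ i, |(q i : ℝ)| ≤ X) ∧ evalThree ζ q ≠ 0 ∧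
      |evalThree ζ q| ≤ X ^ (-η) ∧ ∀ r : Fin 3 → ℤ, cross q r = 0 → evalThree ζ r ≠ 0 →
        |evalThree ζ q| ≤ |evalThree ζ r| := by
    intro X
    by_cases hX : S ≤ X
    · obtain ⟨p, hp, hp0, hpe⟩ := h X (((le_max_left _ _).trans (le_max_left _ _)).trans hX)
      obtain ⟨q, hq⟩ := exists_primitive hp hp0 hpe
      exact ⟨q, fun _ => hq⟩
    · exact ⟨0, fun h => absurd h hX⟩
  choose f hf using hprim
  let X : ℕ → ℝ := fun n => (fun x => 2 * |evalThree ζ (f x)| ^ (-η⁻¹))^[n] S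
  have hXsucc : ∀ j, X (j + 1) = 2 * |evalThree ζ (f (X j))| ^ (-η⁻¹) := fun j =>
    Function.iterate_succ_apply' _ _ _
  have hS1 : 1 ≤ S := le_max_right _ _
  have hgrow : ∀ x, S ≤ x → 2 * x ≤ 2 * |evalThree ζ (f x)| ^ (-η⁻¹) := by
    intro x hx
    obtain ⟨-, h0, hle, -⟩ := hf x hx
    have hx0 : 0 < x := by linarith
    have := Real.rpow_le_rpow_of_nonpos (abs_pos.mpr h0) hle
      (neg_nonpos.mpr (inv_nonneg.mpr hη0.le))
    rw [← Real.rpow_mul hx0.le, neg_mul_neg, mul_inv_cancel₀ hη0.ne', Real.rpow_one] at this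
    linarith
  have hXS : ∀ j, S ≤ X j := by
    intro j
    induction j with
    | zero => exact le_rfl
    | succ j ih =>
      rw [hXsucc]
      linarith [hgrow (X j) ih]
  have hX0 : ∀ j, 0 < X j := fun j => by linarith [hXS j]
  have hdouble : ∀ j, 2 * X j ≤ X (j + 1) := fun j => by
    rw [hXsucc]; exact hgrow (X j) (hXS j)
  have hmono : Monotone X := monotone_nat_of_le_succ fun j => by linarith [hdouble j, hX0 j]
  have hXlim : Tendsto X atTop atTop := by
    have hpow : ∀ j, (2 : ℝ) ^ j ≤ X j := by
      intro j
      induction j with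
      | zero => simpa using hS1.trans (hXS 0)
      | succ j ih => rw [pow_succ]; linarith [hdouble j]
    exact tendsto_atTop_mono hpow (tendsto_pow_atTop_atTop_of_one_lt one_lt_two)
  have heveq : ∀ j, |evalThree ζ (f (X j))| = 2 ^ η * X (j + 1) ^ (-η) := by
    intro j
    have hpos := abs_pos.mpr (hf (X j) (hXS j)).2.1
    rw [hXsucc, Real.mul_rpow (by norm_num) (Real.rpow_nonneg hpos.le _),
      ← Real.rpow_mul hpos.le, neg_mul_neg, inv_mul_cancel₀ hη0.ne', Real.rpow_one, ← mul_assoc,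
      ← Real.rpow_add (by norm_num), add_neg_cancel, Real.rpow_zero, one_mul]
  have hdec : ∀ j, |evalThree ζ (f (X (j + 1)))| < |evalThree ζ (f (X j))| := by
    intro j
    rw [heveq j]
    refine (hf _ (hXS (j + 1))).2.2.1.trans_lt ?_
    exact lt_mul_of_one_lt_left (Real.rpow_pos_of_pos (hX0 _) _)
      (Real.one_lt_rpow one_lt_two hη0)
  have hne : ∀ j, cross (f (X j)) (f (X (j + 1))) ≠ 0 := fun j h0 =>
    absurd ((hf _ (hXS j)).2.2.2 _ h0 (hf _ (hXS (j + 1))).2.1) (not_le.mpr (hdec j))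
  obtain ⟨j, hj⟩ := exists_detThree_ne_zero (C := 2 ^ η) hζ hη hXlim hX0 hmono
    (P := fun j => f (X j)) (fun j => (hf _ (hXS j)).1) (fun j => (heveq j).le)
    (by positivity) hne
  refine ⟨X (j + 1), X (j + 2), f (X j), f (X (j + 1)), f (X (j + 2)),
    ((le_max_right _ _).trans (le_max_left _ _)).trans (hXS _), hmono (Nat.le_succ _),
    fun i => ((hf _ (hXS j)).1 i).trans (hmono (Nat.le_succ _)), (hf _ (hXS _)).1,
    (hf _ (hXS _)).1, (heveq j).le, (heveq (j + 1)).le, ?_, hj⟩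
  exact (hdec (j + 1)).le.trans (heveq (j + 1)).le

lemma abs_coeff_le_polyH (P : ℤ[X]) (i : ℕ) : |(P.coeff i : ℝ)| ≤ polyH P := by
  by_cases hi : i ∈ P.support
  · have := Finset.le_sup (f := fun i => (P.coeff i).natAbs) hi
    rw [← Int.cast_abs, ← Nat.cast_natAbs, polyH]
    exact_mod_cast this
  · rw [notMem_support_iff.mp hi]
    simp [polyH]

lemma pev_eq_evalThree {ζ : ℝ} {P : ℤ[X]} (hP : P.natDegree ≤ 2) :
    pev ζ P = evalThree ζ fun i => P.coeff i := by
  rw [pev, aeval_eq_sum_range' (Nat.lt_succ_of_le hP)]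
  simp [Finset.sum_range_succ, evalThree]

lemma pev_eq_evalFour {ζ : ℝ} {P : ℤ[X]} (hP : P.natDegree ≤ 3) :
    pev ζ P = evalFour ζ fun i => P.coeff i := by
  rw [pev, aeval_eq_sum_range' (Nat.lt_succ_of_le hP)]
  simp [Finset.sum_range_succ, evalFour]

/-- The exponents at which the comparison of determinants is made. -/
lemma eventually_exponents {σ τ : ℝ} (hτ : 0 < τ) (hσ : Real.sqrt 5 < (1 - τ) * σ) :
    ∀ᶠ η in 𝓝 ((3 + Real.sqrt 5) / 2), 2 < η ∧ 2 - η + (η - 1)⁻¹ - τ < 0 ∧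
      2 * (η - 1)⁻¹ + 1 - (1 - τ) * σ < 0 := by
  have h5 : Real.sqrt 5 ^ 2 = 5 := Real.sq_sqrt (by norm_num)
  have h5' : 2 < Real.sqrt 5 := Real.lt_sqrt_of_sq_lt (by norm_num)
  have hinv : ((3 + Real.sqrt 5) / 2 - 1)⁻¹ = (Real.sqrt 5 - 1) / 2 := by
    apply inv_eq_of_mul_eq_one_left
    linear_combination h5 / 4
  have hcont : ContinuousAt (fun η : ℝ => (η - 1)⁻¹) ((3 + Real.sqrt 5) / 2) :=
    (continuousAt_id.sub continuousAt_const).inv₀ (show (3 + Real.sqrt 5) / 2 - 1 ≠ 0 by linarith)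
  have c1 : ContinuousAt (fun η : ℝ => 2 - η + (η - 1)⁻¹ - τ) ((3 + Real.sqrt 5) / 2) :=
    ((continuousAt_const.sub continuousAt_id).add hcont).sub continuousAt_const
  have c2 : ContinuousAt (fun η : ℝ => 2 * (η - 1)⁻¹ + 1 - (1 - τ) * σ)
      ((3 + Real.sqrt 5) / 2) :=
    ((continuousAt_const.mul hcont).add continuousAt_const).sub continuousAt_const
  refine (lt_mem_nhds (by linarith)).and ((c1.eventually_lt_const ?_).and
    (c2.eventually_lt_const ?_))
  · beta_reduce; rw [hinv]; linarith
  · beta_reduce; rw [hinv]; linarith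

lemma eventually_mul_rpow_lt {e : ℝ} (he : e < 0) (K : ℝ) {t : ℝ} (ht : 0 < t) :
    ∀ᶠ x : ℝ in atTop, K * x ^ e < t := by
  have h := (tendsto_rpow_neg_atTop (neg_pos.mpr he)).const_mul K
  rw [neg_neg, mul_zero] at h
  exact h.eventually_lt_const ht

/-- Uniform approximation of exponent `η` by quadratic polynomials prevents irreducible cubic
polynomials from being too small on suitable ranges of heights. -/
lemma exists_no_irreducible_cubic {ζ η σ τ T : ℝ} (hζ : Irrational ζ) (hη : 2 < η)
    (hτ : τ < 1) (h1 : 2 - η + (η - 1)⁻¹ - τ < 0)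
    (h2 : 2 * (η - 1)⁻¹ + 1 - (1 - τ) * σ < 0)
    (h : ∀ X : ℝ, T ≤ X → ∃ p : Fin 3 → ℤ, (∀ i, |(p i : ℝ)| ≤ X) ∧ evalThree ζ p ≠ 0 ∧
      |evalThree ζ p| ≤ X ^ (-η)) (X₀ : ℝ) :
    ∃ X : ℝ, X₀ ≤ X ∧ ¬ ∃ Q : ℤ[X], Irreducible Q ∧ Q.natDegree = 3 ∧
      polyH Q ≤ X ∧ |pev ζ Q| ≤ X ^ (-σ) := by
  set C : ℝ := 2 ^ η with hC
  have hC0 : 0 < C := Real.rpow_pos_of_pos two_pos _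
  set θ : ℝ := (η - 1)⁻¹ with hθ
  set L : ℝ := (6 * C) ^ θ with hL
  have hL0 : 0 < L := Real.rpow_pos_of_pos (by positivity) _
  have hη1 : 0 < η - 1 := by linarith
  obtain ⟨M, hM⟩ := eventually_atTop.mp
    ((eventually_mul_rpow_lt (e := 2 - η) (by linarith) C (by norm_num : (0 : ℝ) < 1 / 5)).and
    ((eventually_mul_rpow_lt h1 (12 * (1 + |ζ|) * (L * C)) (by norm_num : (0 : ℝ) < 1 / 2)).and
    ((eventually_mul_rpow_lt h2 (6 * L ^ 2) (by norm_num : (0 : ℝ) < 1 / 2)).and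
    ((tendsto_rpow_atTop (sub_pos.mpr hτ)).eventually_ge_atTop X₀))))
  obtain ⟨A, B, p, q, r, hMA, hAB, hp, hq, hr, hep, heq, her, hdet⟩ :=
    exists_independent_triple hζ (by linarith) h (max M 1)
  have hA1 : 1 ≤ A := (le_max_right _ _).trans hMA
  have hA0 : 0 < A := by linarith
  have hB0 : 0 < B := by linarith
  have hAM : M ≤ A := (le_max_left _ _).trans hMA
  obtain ⟨-, hM1, hM2, hM3⟩ := hM B (hAM.trans hAB)
  have hMA' := (hM A hAM).1
  have hFE : C * B ^ (-η) ≤ C * A ^ (-η) := mul_le_mul_of_nonneg_left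
    (Real.rpow_le_rpow_of_nonpos hA0 hAB (by linarith)) hC0.le
  have hABle : A ≤ L * B ^ θ := by
    have hone := one_le_of_detThree_ne_zero hp hq hr hAB hep heq her hFE hdet
    have e : A ^ (η - 1) * (A * A ^ (-η)) = 1 := by
      rw [← Real.rpow_one_add' hA0.le (by linarith), ← Real.rpow_add hA0,
        show η - 1 + (1 + -η) = 0 by ring, Real.rpow_zero]
    have hpow : A ^ (η - 1) ≤ 6 * C * B := by
      have := mul_le_mul_of_nonneg_left hone (Real.rpow_nonneg hA0.le (η - 1))
      calc A ^ (η - 1) = A ^ (η - 1) * 1 := (mul_one _).symm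
        _ ≤ _ := this
        _ = 6 * C * B * (A ^ (η - 1) * (A * A ^ (-η))) := by ring
        _ = _ := by rw [e, mul_one]
    have := Real.rpow_le_rpow (Real.rpow_nonneg hA0.le _) hpow (inv_nonneg.mpr hη1.le)
    rwa [← Real.rpow_mul hA0.le, mul_inv_cancel₀ hη1.ne', Real.rpow_one,
      Real.mul_rpow (by positivity) hB0.le] at this
  have hE : A ^ 2 * (C * A ^ (-η)) < 1 / 5 := by
    convert hMA' using 1
    rw [sub_eq_add_neg, Real.rpow_add hA0, Real.rpow_two]
    ring
  have hF : A * B * (C * B ^ (-η)) < 1 / 5 := by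
    have hmon : B * B ^ (-η) ≤ A * A ^ (-η) := by
      rw [← Real.rpow_one_add' hA0.le (by linarith), ← Real.rpow_one_add' hB0.le (by linarith)]
      exact Real.rpow_le_rpow_of_nonpos hA0 hAB (by linarith)
    calc A * B * (C * B ^ (-η)) = A * C * (B * B ^ (-η)) := by ring
      _ ≤ A * C * (A * A ^ (-η)) := mul_le_mul_of_nonneg_left hmon (by positivity)
      _ = A ^ 2 * (C * A ^ (-η)) := by ring
      _ < _ := hE
  have hres := cross_one_sq_ne hp hq hr hAB hep heq her hE hF hdet
  refine ⟨B ^ (1 - τ), hM3, ?_⟩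
  rintro ⟨Q, hQ, hdeg, hH, hsmall⟩
  have hs : ∀ i : Fin 4, |(Q.coeff i : ℝ)| ≤ B ^ (1 - τ) := fun i =>
    (abs_coeff_le_polyH Q i).trans hH
  rw [pev_eq_evalFour hdeg.le] at hsmall
  have hY : 12 * (1 + |ζ|) * (A * B * B ^ (1 - τ) * (C * B ^ (-η))) < 1 / 2 := by
    refine lt_of_le_of_lt ?_ hM1
    calc 12 * (1 + |ζ|) * (A * B * B ^ (1 - τ) * (C * B ^ (-η)))
        ≤ 12 * (1 + |ζ|) * (L * B ^ θ * B * B ^ (1 - τ) * (C * B ^ (-η))) := by gcongr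
      _ = 12 * (1 + |ζ|) * (L * C) * (B ^ θ * B ^ (1 : ℝ) * B ^ (1 - τ) * B ^ (-η)) := by
          rw [Real.rpow_one]; ring
      _ = _ := by
          rw [← Real.rpow_add hB0, ← Real.rpow_add hB0, ← Real.rpow_add hB0]
          ring_nf
  have hG : 6 * (A ^ 2 * B * (B ^ (1 - τ)) ^ (-σ)) < 1 / 2 := by
    refine lt_of_le_of_lt ?_ hM2
    calc 6 * (A ^ 2 * B * (B ^ (1 - τ)) ^ (-σ))
        ≤ 6 * ((L * B ^ θ) ^ 2 * B * (B ^ (1 - τ)) ^ (-σ)) := by gcongr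
      _ = 6 * L ^ 2 * (B ^ θ * B ^ θ * B ^ (1 : ℝ) * B ^ ((1 - τ) * (-σ))) := by
          rw [Real.rpow_one, Real.rpow_mul hB0.le]; ring
      _ = _ := by
          rw [← Real.rpow_add hB0, ← Real.rpow_add hB0, ← Real.rpow_add hB0]
          ring_nf
  obtain ⟨n, u, v, hn, hmul⟩ := exists_mul_eq_shift (s := fun i => Q.coeff i) hq hr hs hAB
    heq her hsmall hY hG hres
  exact not_mul_eq_shift hQ hdeg hn hmul

lemma exists_evalThree_of_mem_whSet {ζ η : ℝ} (h : η ∈ whSet 2 ζ) :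
    ∃ T : ℝ, ∀ X : ℝ, T ≤ X → ∃ p : Fin 3 → ℤ, (∀ i, |(p i : ℝ)| ≤ X) ∧ evalThree ζ p ≠ 0 ∧
      |evalThree ζ p| ≤ X ^ (-η) := by
  obtain ⟨T, hT⟩ := h
  refine ⟨T, fun X hX => ?_⟩
  obtain ⟨P, hdeg, hH, h0, hle⟩ := hT X hX
  rw [pev_eq_evalThree hdeg] at h0 hle
  exact ⟨_, fun i => (abs_coeff_le_polyH P i).trans hH, abs_pos.mp h0, hle⟩

theorem extremal_cubic_uniform_gap (ζ : ℝ) (hζ : IsExtremal ζ) (ε : ℝ) (hε : 0 < ε) :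
    ∀ X₀ : ℝ, ∃ X : ℝ, X₀ ≤ X ∧
      ¬ ∃ Q : Polynomial ℤ, Irreducible Q ∧ Q.natDegree = 3 ∧
        polyH Q ≤ X ∧ |pev ζ Q| ≤ X ^ (-Real.sqrt 5 - ε) := by
  obtain ⟨htr, hwh⟩ := hζ
  have hirr : Irrational ζ := htr.irrational
  have h5 : 0 < Real.sqrt 5 := Real.sqrt_pos.mpr (by norm_num)
  have hlub : IsLUB (whSet 2 ζ) ((3 + Real.sqrt 5) / 2) := by
    rw [← hwh]
    have hne0 : sSup (whSet 2 ζ) ≠ 0 := by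
      have : sSup (whSet 2 ζ) = (3 + Real.sqrt 5) / 2 := hwh
      rw [this]; positivity
    refine isLUB_csSup ?_ ?_
    · by_contra he
      rw [Set.not_nonempty_iff_eq_empty] at he
      exact hne0 (by rw [he, Real.sSup_empty])
    · by_contra hb
      exact hne0 (Real.sSup_of_not_bddAbove hb)
  set τ := ε / (2 * (Real.sqrt 5 + ε)) with hτ
  have hτ0 : 0 < τ := by positivity
  have hτmul : τ * (Real.sqrt 5 + ε) = ε / 2 := by rw [hτ]; field_simp
  have hτ1 : τ < 1 := by rw [hτ, div_lt_one (by positivity)]; linarith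
  obtain ⟨l, hl, hsub⟩ := exists_Ioc_subset_of_mem_nhds
    (eventually_exponents (σ := Real.sqrt 5 + ε) hτ0 (by linarith)) ⟨_, sub_one_lt _⟩
  obtain ⟨η, hη, hlη, hle⟩ := hlub.exists_between hl
  obtain ⟨h2, he1, he2⟩ := hsub ⟨hlη, hle⟩
  obtain ⟨T, hT⟩ := exists_evalThree_of_mem_whSet hη
  rw [show -Real.sqrt 5 - ε = -(Real.sqrt 5 + ε) by ring]
  exact exists_no_irreducible_cubic hirr h2 hτ1 he1 he2 hT
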